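/- Let Ω be a body in ℝ^m and suppose the kernel k : (0,∞) → ℝ is strictly decreasing and satisfies condition (C⁰_α) for some α > 0. Then every k-center of Ω (i.e., every maximum point of the potential K_Ω) belongs to the minimal unfolded region Uf(Ω). -/

import Mathlib

open Set MeasureTheory Filter Asymptotics Metric
open scoped Topology RealInnerProductSpace

noncomputable section

/-- `m`-dimensional Euclidean space. -/
abbrev Euc (m : ℕ) := EuclideanSpace ℝ (Fin m)

/-- A body: the closure of a nonempty bounded open set. -/
def IsBody {m : ℕ} (Ω : Set (Euc m)) : Prop :=
  ∃ U : Set (Euc m), IsOpen U ∧ U.Nonempty ∧ Bornology.IsBounded U ∧ Ω = closure U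

/-- The potential `K_Ω(x) = ∫_Ω k(|x - y|) dy`. -/
def pot {m : ℕ} (k : ℝ → ℝ) (Ω : Set (Euc m)) (x : Euc m) : ℝ :=
  ∫ y in Ω, k (dist x y)

/-- Condition `(C⁰_α)`. -/
def CondC0 (m : ℕ) (α : ℝ) (k : ℝ → ℝ) : Prop :=
  ContinuousOn k (Ioi 0) ∧
  (α < m → k =O[𝓝[>] (0:ℝ)] fun r : ℝ => r ^ (α - m)) ∧
  (α = m → k =O[𝓝[>] (0:ℝ)] fun r : ℝ => Real.log r) ∧
  ((m : ℝ) < α → k =O[𝓝[>] (0:ℝ)] fun _ : ℝ => (1:ℝ))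

/-- Condition `(C¹_α)`. -/
def CondC1 (m : ℕ) (α : ℝ) (k : ℝ → ℝ) : Prop :=
  ContDiffOn ℝ 1 k (Ioi 0) ∧
  (α < m → k =O[𝓝[>] (0:ℝ)] fun r : ℝ => r ^ (α - m)) ∧
  (α = m → k =O[𝓝[>] (0:ℝ)] fun r : ℝ => Real.log r) ∧
  ((m : ℝ) < α → k =O[𝓝[>] (0:ℝ)] fun _ : ℝ => (1:ℝ)) ∧
  (α < m + 1 → deriv k =O[𝓝[>] (0:ℝ)] fun r : ℝ => r ^ (α - m - 1)) ∧
  (α = m + 1 → deriv k =O[𝓝[>] (0:ℝ)] fun r : ℝ => Real.log r) ∧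
  ((m : ℝ) + 1 < α → deriv k =O[𝓝[>] (0:ℝ)] fun _ : ℝ => (1:ℝ))

/-- Reflection of `ℝ^m` in the hyperplane `{z : z ⬝ v = b}` (for a unit vector `v`). -/
def reflAt {m : ℕ} (v : Euc m) (b : ℝ) (z : Euc m) : Euc m :=
  z + (2 * (b - ⟪z, v⟫)) • v

/-- `Ω⁺_{v,b}`, the part of `Ω` of height at least `b` in direction `v`. -/
def upSet {m : ℕ} (Ω : Set (Euc m)) (v : Euc m) (b : ℝ) : Set (Euc m) :=
  {z ∈ Ω | b ≤ ⟪z, v⟫}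

/-- The minimum folding height `l(v)`. -/
def foldHeight {m : ℕ} (Ω : Set (Euc m)) (v : Euc m) : ℝ :=
  sInf {a : ℝ | ∀ b ≥ a, reflAt v b '' upSet Ω v b ⊆ Ω}

/-- The minimal unfolded region `Uf(Ω)`. -/
def unfolded {m : ℕ} (Ω : Set (Euc m)) : Set (Euc m) :=
  ⋂ v ∈ sphere (0 : Euc m) 1, {z : Euc m | ⟪z, v⟫ ≤ foldHeight Ω v}

/-- `Ω` is convex in the direction `v`: every line parallel to `v` meets `Ω` in a connected set. -/
def ConvexInDir {m : ℕ} (Ω : Set (Euc m)) (v : Euc m) : Prop :=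
  ∀ z : Euc m, ⟪z, v⟫ = 0 → IsPreconnected (Ω ∩ {w : Euc m | ∃ t : ℝ, w = z + t • v})

/-- `d(Ω) = min {|z - w| : z ∈ Uf(Ω), w ∈ ∂Ω}`. -/
def dMin {m : ℕ} (Ω : Set (Euc m)) : ℝ :=
  sInf {d : ℝ | ∃ z ∈ unfolded Ω, ∃ w ∈ frontier Ω, d = dist z w}

/-- `D(Ω) = max {|z - w| : z ∈ Uf(Ω), w ∈ ∂Ω}`. -/
def dMax {m : ℕ} (Ω : Set (Euc m)) : ℝ :=
  sSup {d : ℝ | ∃ z ∈ unfolded Ω, ∃ w ∈ frontier Ω, d = dist z w}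

/-- The `r^{α-m}`-potential `V^{(α)}_Ω`. -/
def rpot (m : ℕ) (α : ℝ) (Ω : Set (Euc m)) (x : Euc m) : ℝ :=
  if α = (m : ℝ) then -∫ y in Ω, Real.log (dist x y)
  else Real.sign ((m : ℝ) - α) * ∫ y in Ω, dist x y ^ (α - (m : ℝ))

/-- The solid-angle (Poisson) potential `A_Ω(x, h)`. -/
def apot (m : ℕ) (Ω : Set (Euc m)) (x : Euc m) (h : ℝ) : ℝ :=
  ∫ y in Ω, h / (dist x y ^ 2 + h ^ 2) ^ (((m : ℝ) + 1) / 2)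

/-- Condition `(C⁰_α)` bounds the kernel near `0` by an integrable power. -/
lemma CondC0.exists_isBigO_rpow {m : ℕ} {α : ℝ} {k : ℝ → ℝ} (hm : 0 < m) (hα : 0 < α)
    (hk : CondC0 m α k) :
    ∃ s : ℝ, 0 < s ∧ s < m ∧ k =O[𝓝[>] (0:ℝ)] fun r : ℝ => r ^ (-s) := by
  obtain ⟨-, h1, h2, h3⟩ := hk
  have hm' : (1:ℝ) ≤ m := by exact_mod_cast hm
  rcases lt_trichotomy α m with h | h | h
  · exact ⟨m - α, by linarith, by linarith, by simpa using h1 h⟩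
  · exact ⟨1 / 2, by norm_num, by linarith,
      (h2 h).trans (isLittleO_log_rpow_nhdsGT_zero (by norm_num)).isBigO⟩
  · refine ⟨1 / 2, by norm_num, by linarith, (h3 h).trans (IsBigO.of_bound 1 ?_)⟩
    filter_upwards [Ioo_mem_nhdsGT (zero_lt_one (α := ℝ))] with r hr
    have : 1 ≤ r ^ (-(1 / 2) : ℝ) :=
      Real.one_le_rpow_of_pos_of_le_one_of_nonpos hr.1 hr.2.le (by norm_num)
    simpa using this.trans (le_abs_self _)

lemma AntitoneOn.exists_norm_le_rpow {k : ℝ → ℝ} {s : ℝ} (hs : 0 < s)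
    (hdec : AntitoneOn k (Ioi 0)) (hO : k =O[𝓝[>] (0:ℝ)] fun r : ℝ => r ^ (-s)) (R : ℝ) :
    ∃ C : ℝ, ∀ r ∈ Ioo 0 R, ‖k r‖ ≤ C * r ^ (-s) := by
  obtain ⟨C, hC, hb⟩ := hO.exists_pos
  obtain ⟨ε, hε, hεs⟩ := (mem_nhdsGT_iff_exists_Ioo_subset).1 hb.bound
  have hε : 0 < ε := hε
  refine ⟨C + (|k ε| + |k R|) * R ^ s, fun r hr => ?_⟩
  have hR : 0 < R := hr.1.trans hr.2
  have hpos : 0 < r ^ (-s) := Real.rpow_pos_of_pos hr.1 _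
  rcases lt_or_ge r ε with h | h
  · have h1 : ‖k r‖ ≤ C * ‖r ^ (-s)‖ := hεs ⟨hr.1, h⟩
    rw [Real.norm_of_nonneg hpos.le] at h1
    refine h1.trans (mul_le_mul_of_nonneg_right ?_ hpos.le)
    have : 0 ≤ (|k ε| + |k R|) * R ^ s := by positivity
    linarith
  · have h1 : k r ≤ k ε := hdec hε hr.1 h
    have h2 : k R ≤ k r := hdec hr.1 hR hr.2.le
    have h3 : |k r| ≤ |k ε| + |k R| := by
      rw [abs_le]
      constructor
      · linarith [neg_abs_le (k R), abs_nonneg (k ε)]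
      · linarith [le_abs_self (k ε), abs_nonneg (k R)]
    have h4 : 1 ≤ R ^ s * r ^ (-s) := by
      rw [Real.rpow_neg hr.1.le, ← div_eq_mul_inv, one_le_div (Real.rpow_pos_of_pos hr.1 _)]
      exact Real.rpow_le_rpow hr.1.le hr.2.le hs.le
    calc ‖k r‖ ≤ (|k ε| + |k R|) * 1 := by simpa using h3
      _ ≤ (|k ε| + |k R|) * (R ^ s * r ^ (-s)) := by gcongr
      _ ≤ (C + (|k ε| + |k R|) * R ^ s) * r ^ (-s) := by
        have := mul_pos hC hpos
        linarith

/-- The potential of a bounded set is given by a convergent integral. -/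
lemma CondC0.integrableOn_dist {m : ℕ} {α : ℝ} {k : ℝ → ℝ} (hm : 0 < m) (hα : 0 < α)
    (hk : CondC0 m α k) (hdec : AntitoneOn k (Ioi 0)) {Ω : Set (Euc m)}
    (hΩ : Bornology.IsBounded Ω) (x : Euc m) :
    IntegrableOn (fun y => k (dist x y)) Ω := by
  have : NeZero m := ⟨hm.ne'⟩
  obtain ⟨s, hs, hsm, hO⟩ := hk.exists_isBigO_rpow hm hα
  obtain ⟨R, hR⟩ := hΩ.subset_ball x
  obtain ⟨C, hC⟩ := AntitoneOn.exists_norm_le_rpow hs hdec hO R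
  have hae : ∀ᵐ z : Euc m, z ≠ 0 := Measure.ae_ne volume 0
  have hmeas : AEStronglyMeasurable (fun z : Euc m => k ‖z‖) volume := by
    have : ContinuousOn (fun z : Euc m => k ‖z‖) {0}ᶜ :=
      hk.1.comp continuous_norm.continuousOn fun z hz => norm_pos_iff.2 hz
    have h := this.aestronglyMeasurable (μ := volume) (measurableSet_singleton _).compl
    rwa [restrict_compl_singleton] at h
  have hball : IntegrableOn (fun z : Euc m => k ‖z‖) (ball 0 R) := by
    refine integrableOn_ball_of_norm_le_rpow (C := C) (α := s) ?_ ?_ ?_ hmeas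
    · simpa using Nat.succ_le_of_lt hm
    · simpa using hsm
    · filter_upwards [ae_restrict_of_ae hae, ae_restrict_mem measurableSet_ball] with z hz hzR
      exact hC _ ⟨norm_pos_iff.2 hz, by simpa using hzR⟩
  have hmp : MeasurePreserving (fun y : Euc m => y - x) := measurePreserving_sub_right volume x
  have hemb : MeasurableEmbedding (fun y : Euc m => y - x) :=
    (MeasurableEquiv.subRight x).measurableEmbedding
  have h := (hmp.integrableOn_comp_preimage hemb).2 hball
  refine (h.mono_set ?_).congr_fun_ae (.of_forall fun y => ?_)
  · intro y hy
    simpa [dist_eq_norm] using hR hy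
  · simp [dist_eq_norm, norm_sub_rev x y]

section Reflection

variable {m : ℕ} {v : Euc m} {b : ℝ}

lemma inner_reflAt (hv : ‖v‖ = 1) (z : Euc m) : ⟪reflAt v b z, v⟫ = 2 * b - ⟪z, v⟫ := by
  simp only [reflAt, inner_add_left, real_inner_smul_left, real_inner_self_eq_norm_sq, hv]
  ring

lemma reflAt_involutive (hv : ‖v‖ = 1) : Function.Involutive (reflAt v b) := by
  intro z
  rw [reflAt, inner_reflAt hv, reflAt, add_assoc, ← add_smul]
  convert add_zero z
  rw [show 2 * (b - ⟪z, v⟫) + 2 * (b - (2 * b - ⟪z, v⟫)) = 0 by ring, zero_smul]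

lemma reflAt_eq_reflection (hv : ‖v‖ = 1) (z : Euc m) :
    reflAt v b z = (ℝ ∙ v)ᗮ.reflection z + (2 * b) • v := by
  rw [Submodule.reflection_orthogonal_apply, Submodule.reflection_singleton_apply, reflAt, hv,
    real_inner_comm]
  simp only [RCLike.ofReal_real_eq_id, id, one_pow, div_one]
  module

lemma measurePreserving_reflAt (hv : ‖v‖ = 1) : MeasurePreserving (reflAt v b) := by
  have : reflAt v b = (fun z => z + (2 * b) • v) ∘ (ℝ ∙ v)ᗮ.reflection :=
    funext (reflAt_eq_reflection hv)
  rw [this]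
  exact (measurePreserving_add_right volume _).comp
    (LinearIsometryEquiv.measurePreserving _)

lemma isometry_reflAt (hv : ‖v‖ = 1) : Isometry (reflAt v b) := by
  refine Isometry.of_dist_eq fun y z => ?_
  simp [reflAt_eq_reflection hv]

lemma dist_reflAt_left (hv : ‖v‖ = 1) (x y : Euc m) :
    dist (reflAt v b x) y = dist x (reflAt v b y) := by
  rw [← (isometry_reflAt hv).dist_eq (reflAt v b x), reflAt_involutive hv]

lemma measurableEmbedding_reflAt (hv : ‖v‖ = 1) : MeasurableEmbedding (reflAt v b) :=
  ((isometry_reflAt hv).isEmbedding.toHomeomorphOfSurjective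
    (reflAt_involutive hv).surjective).measurableEmbedding

lemma dist_reflAt_lt (hv : ‖v‖ = 1) {x y : Euc m} (hx : b < ⟪x, v⟫) (hy : ⟪y, v⟫ < b) :
    dist (reflAt v b x) y < dist x y := by
  rw [dist_eq_norm, dist_eq_norm, ← sq_lt_sq₀ (norm_nonneg _) (norm_nonneg _)]
  have : reflAt v b x - y = (x - y) + (2 * (b - ⟪x, v⟫)) • v := by
    rw [reflAt]
    abel
  rw [this, norm_add_sq_real, real_inner_smul_right, norm_smul, hv, inner_sub_left, mul_one,
    Real.norm_eq_abs, sq_abs]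
  nlinarith [mul_pos (sub_pos.2 hx) (sub_pos.2 hy)]

end Reflection

/-- If the part above a hyperplane folds into the body and the potential does not increase when a
point above the hyperplane is reflected, then the body is symmetric in the hyperplane. -/
lemma image_reflAt_subset_of_pot_le {m : ℕ} {Ω : Set (Euc m)} (hΩ : IsBody Ω) {k : ℝ → ℝ}
    (hdec : StrictAntiOn k (Ioi 0)) {v : Euc m} (hv : ‖v‖ = 1) {b : ℝ}
    (hfold : reflAt v b '' upSet Ω v b ⊆ Ω) {x : Euc m} (hx : b < ⟪x, v⟫)
    (hint : ∀ z, IntegrableOn (fun y => k (dist z y)) Ω)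
    (hle : pot k Ω (reflAt v b x) ≤ pot k Ω x) :
    reflAt v b '' Ω ⊆ Ω := by
  have : Nontrivial (Euc m) := ⟨v, 0, fun h => by simp [h] at hv⟩
  set R := reflAt v b with hR
  have hinv : Function.Involutive R := reflAt_involutive hv
  have hcont : Continuous R := (isometry_reflAt hv).continuous
  obtain ⟨U, hU, -, -, rfl⟩ := hΩ
  set Ω := closure U
  have hΩc : IsClosed Ω := isClosed_closure
  have hSm : MeasurableSet (R ⁻¹' Ω) := (hΩc.preimage hcont).measurableSet
  set g : Euc m → ℝ := fun y => k (dist (R x) y) - k (dist x y) with hg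
  have hgint : IntegrableOn g Ω := (hint _).sub (hint _)
  have hgR : ∀ y, g (R y) = -g y := fun y => by
    simp only [hg, neg_sub]
    rw [← dist_reflAt_left hv, ← hR, hinv x, dist_reflAt_left hv]
  have hsym : ∫ y in Ω ∩ R ⁻¹' Ω, g y = 0 := by
    have h := (measurePreserving_reflAt (b := b) hv).setIntegral_preimage_emb
      (measurableEmbedding_reflAt hv) g (Ω ∩ R ⁻¹' Ω)
    rw [← hR, preimage_inter, ← preimage_comp, hinv.comp_self, preimage_id, inter_comm] at h
    simp only [hgR, integral_neg] at h
    linarith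
  have hlow : ∀ y ∈ Ω \ R ⁻¹' Ω, ⟪y, v⟫ < b := fun y hy => by
    by_contra! hc
    exact hy.2 (hfold ⟨y, ⟨hy.1, hc⟩, rfl⟩)
  have hpos : ∀ y ∈ Ω \ R ⁻¹' Ω, y ≠ R x → 0 < g y := fun y hy hne =>
    sub_pos.2 (hdec (dist_pos.2 hne.symm)
      ((dist_pos.2 hne.symm).trans (dist_reflAt_lt hv hx (hlow y hy)))
      (dist_reflAt_lt hv hx (hlow y hy)))
  have htot : ∫ y in Ω \ R ⁻¹' Ω, g y ≤ 0 := by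
    have h1 : ∫ y in Ω, g y = pot k Ω (R x) - pot k Ω x := integral_sub (hint _) (hint _)
    have h2 := integral_inter_add_sdiff hSm hgint
    linarith
  have hae : ∀ᵐ y : Euc m, y ≠ R x := Measure.ae_ne volume (R x)
  have hnull : volume (Ω \ R ⁻¹' Ω) = 0 := by
    have hnn : 0 ≤ᵐ[volume.restrict (Ω \ R ⁻¹' Ω)] g := by
      filter_upwards [ae_restrict_of_ae hae,
        ae_restrict_mem (hΩc.measurableSet.diff hSm)] with y hy hyS
      exact (hpos y hyS hy).le
    have h := (setIntegral_pos_iff_support_of_nonneg_ae hnn (hgint.mono_set sdiff_subset)).not.1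
      htot.not_gt
    rw [not_lt, nonpos_iff_eq_zero] at h
    refine measure_mono_null (t := (Function.support g ∩ (Ω \ R ⁻¹' Ω)) ∪ {R x}) ?_
      (measure_union_null h (measure_singleton _))
    intro y hy
    by_cases hyx : y = R x
    · exact Or.inr hyx
    · exact Or.inl ⟨(hpos y hy hyx).ne', hy⟩
  have hempty : U \ R ⁻¹' Ω = ∅ :=
    ((hU.sdiff (hΩc.preimage hcont)).measure_eq_zero_iff volume).1
      (measure_mono_null (sdiff_subset_sdiff_left subset_closure) hnull)
  rw [image_subset_iff]
  exact closure_minimal (sdiff_eq_empty.1 hempty) (hΩc.preimage hcont)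

/-- A nonempty compact set is symmetric in at most one hyperplane of a given direction. -/
lemma not_image_reflAt_subset_of_lt {m : ℕ} {Ω : Set (Euc m)} (hc : IsCompact Ω)
    (hne : Ω.Nonempty) {v : Euc m} (hv : ‖v‖ = 1) {b c : ℝ} (hbc : b < c)
    (hb : reflAt v b '' Ω ⊆ Ω) : ¬ reflAt v c '' Ω ⊆ Ω := by
  intro h
  obtain ⟨p, hp, hmax⟩ := hc.exists_isMaxOn hne
    (f := fun z => ⟪z, v⟫) (by fun_prop)
  have := hmax (h ⟨_, hb ⟨p, hp, rfl⟩, rfl⟩)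
  simp only [mem_ofPred_eq, inner_reflAt hv] at this
  linarith

lemma foldHeight_set_nonempty {m : ℕ} {Ω : Set (Euc m)} (hc : IsCompact Ω) (v : Euc m) :
    {a : ℝ | ∀ b ≥ a, reflAt v b '' upSet Ω v b ⊆ Ω}.Nonempty := by
  obtain ⟨M, hM⟩ := (hc.image_of_continuousOn (f := fun z => ⟪z, v⟫) (by fun_prop)).bddAbove
  refine ⟨M + 1, fun b hb => ?_⟩
  rintro _ ⟨z, ⟨hz, hzb⟩, rfl⟩
  have : ⟪z, v⟫ ≤ M := hM ⟨z, hz, rfl⟩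
  linarith

/-- every `k`-center belongs to the minimal unfolded region. -/
theorem kCenter_mem_unfolded {m : ℕ} (Ω : Set (Euc m)) (hΩ : IsBody Ω)
    (k : ℝ → ℝ) (hdec : StrictAntiOn k (Ioi 0)) (α : ℝ) (hα : 0 < α)
    (hk : CondC0 m α k) :
    ∀ x : Euc m, (∀ y : Euc m, pot k Ω y ≤ pot k Ω x) → x ∈ unfolded Ω := by
  intro x hx
  have hbdd : Bornology.IsBounded Ω := by
    obtain ⟨U, -, -, hU, rfl⟩ := hΩ
    exact hU.closure
  have hcl : IsClosed Ω := by
    obtain ⟨U, -, -, -, rfl⟩ := hΩ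
    exact isClosed_closure
  have hne : Ω.Nonempty := by
    obtain ⟨U, -, hU, -, rfl⟩ := hΩ
    exact hU.closure
  have hc : IsCompact Ω := isCompact_of_isClosed_isBounded hcl hbdd
  refine mem_iInter₂.2 fun v hv => ?_
  have hv : ‖v‖ = 1 := by simpa using hv
  have hm : 0 < m := by
    rcases Nat.eq_zero_or_pos m with rfl | h
    · simp [Subsingleton.elim v 0] at hv
    · exact h
  refine le_csInf (foldHeight_set_nonempty hc v) fun a ha => ?_
  by_contra! hlt
  obtain ⟨b, hab, hbx⟩ := exists_between hlt
  have hsymm : ∀ c, a ≤ c → c < ⟪x, v⟫ → reflAt v c '' Ω ⊆ Ω := fun c hac hcx =>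
    image_reflAt_subset_of_pot_le hΩ hdec hv (ha c hac) hcx
      (hk.integrableOn_dist hm hα hdec.antitoneOn hbdd) (hx _)
  exact not_image_reflAt_subset_of_lt hc hne hv hab (hsymm a le_rfl hlt) (hsymm b hab.le hbx)
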